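/- Let Δ : ℝ^d → ℝ be a differentiable function, θ* ∈ ℝ^d, and let (θ_t)_{t≥0} be a sequence in ℝ^d. Suppose there is a set U ⊆ ℝ^d, an index t₀, and constants q ∈ (0,1), L_Δ > 0, μ_Δ > 0 such that: (i) θ_t ∈ U for all t ≥ t₀; (ii) ‖θ_{t+1} − θ*‖ ≤ q·‖θ_t − θ*‖ for all t ≥ t₀; (iii) μ_Δ·‖θ − θ*‖ ≤ ‖∇Δ(θ)‖ ≤ L_Δ·‖θ − θ*‖ for all θ ∈ U. Set ρ := L_Δ·q/μ_Δ and assume ρ < 1. Then for every t ≥ t₀, ‖∇Δ(θ_t)‖ ≤ ρ^{t−t₀}·‖∇Δ(θ_{t₀})‖; in particular, for any t ≥ t₀ with ∇Δ(θ_t) ≠ 0, one has the strict inequality ‖∇Δ(θ_{t+1})‖ < ‖∇Δ(θ_t)‖. -/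

import Mathlib

/-- Iterated (geometric-decay) form of Proposition 1, together
with the strict-decrease conclusion: for every `t ≥ t₀`,
`‖∇Δ(θ_t)‖ ≤ ρ^{t−t₀}·‖∇Δ(θ_{t₀})‖`, and whenever `∇Δ(θ_t) ≠ 0` for `t ≥ t₀`,
`‖∇Δ(θ_{t+1})‖ < ‖∇Δ(θ_t)‖`. -/
theorem grad_discrepancy_geometric_decay
    {d : ℕ} (Δ : EuclideanSpace ℝ (Fin d) → ℝ) (hΔ : Differentiable ℝ Δ)
    (θstar : EuclideanSpace ℝ (Fin d)) (θ : ℕ → EuclideanSpace ℝ (Fin d))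
    (U : Set (EuclideanSpace ℝ (Fin d))) (t₀ : ℕ)
    (q L μ : ℝ) (hq0 : 0 < q) (hq1 : q < 1) (hL : 0 < L) (hμ : 0 < μ)
    (hU : ∀ t, t₀ ≤ t → θ t ∈ U)
    (hS1 : ∀ t, t₀ ≤ t → ‖θ (t + 1) - θstar‖ ≤ q * ‖θ t - θstar‖)
    (hS2 : ∀ ξ ∈ U, μ * ‖ξ - θstar‖ ≤ ‖gradient Δ ξ‖ ∧
                    ‖gradient Δ ξ‖ ≤ L * ‖ξ - θstar‖)
    (hρ : L * q / μ < 1) :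
    (∀ t, t₀ ≤ t →
      ‖gradient Δ (θ t)‖ ≤ (L * q / μ) ^ (t - t₀) * ‖gradient Δ (θ t₀)‖) ∧
    (∀ t, t₀ ≤ t → gradient Δ (θ t) ≠ 0 →
      ‖gradient Δ (θ (t + 1))‖ < ‖gradient Δ (θ t)‖) := by
  have step : ∀ t, t₀ ≤ t →
      ‖gradient Δ (θ (t + 1))‖ ≤ L * q / μ * ‖gradient Δ (θ t)‖ := by
    intro t ht
    calc ‖gradient Δ (θ (t + 1))‖
        ≤ L * ‖θ (t + 1) - θstar‖ := (hS2 _ (hU _ (by omega))).2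
      _ ≤ L * (q * ‖θ t - θstar‖) := by gcongr; exact hS1 t ht
      _ = L * q / μ * (μ * ‖θ t - θstar‖) := by field_simp
      _ ≤ L * q / μ * ‖gradient Δ (θ t)‖ := by gcongr; exact (hS2 _ (hU t ht)).1
  refine ⟨fun t ht => ?_, fun t ht hne => ?_⟩
  · induction t, ht using Nat.le_induction with
    | base => simp
    | succ t ht ih =>
      calc ‖gradient Δ (θ (t + 1))‖
          ≤ L * q / μ * ‖gradient Δ (θ t)‖ := step t ht
        _ ≤ L * q / μ * ((L * q / μ) ^ (t - t₀) * ‖gradient Δ (θ t₀)‖) := by gcongr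
        _ = (L * q / μ) ^ (t + 1 - t₀) * ‖gradient Δ (θ t₀)‖ := by
          rw [Nat.sub_add_comm ht, pow_succ']
          ring
  · exact (step t ht).trans_lt (mul_lt_of_lt_one_left (norm_pos_iff.mpr hne) hρ)
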